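/- Let r ≥ 3 and let M be an edge-colored complete graph on r+1 vertices whose edges receive at least C(r,2) + 1 = r(r−1)/2 + 1 different colors. Then there is an r-clique K ⊆ M whose edges receive at least C(r−1,2) + 2 = (r−1)(r−2)/2 + 2 different colors. -/

import Mathlib

open Finset

/-- The set of colors appearing on edges (non-diagonal pairs) inside the vertex set `S`. -/
def colorsOn {m : ℕ} (f : Sym2 (Fin m) → ℕ) (S : Finset (Fin m)) : Finset ℕ :=
  ((S ×ˢ S).filter fun p => p.1 ≠ p.2).image fun p => f s(p.1, p.2)

theorem mem_colorsOn_iff {m : ℕ} (f : Sym2 (Fin m) → ℕ) (S : Finset (Fin m)) (k : ℕ) :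
    k ∈ colorsOn f S ↔ ∃ a b, a ∈ S ∧ b ∈ S ∧ a ≠ b ∧ f s(a, b) = k := by
  simp only [colorsOn, Finset.mem_image, Finset.mem_filter, Finset.mem_product, Prod.exists]
  constructor
  · rintro ⟨a, b, ⟨⟨h1, h2⟩, h3⟩, h4⟩
    exact ⟨a, b, h1, h2, h3, h4⟩
  · rintro ⟨a, b, h1, h2, h3, h4⟩
    exact ⟨a, b, ⟨⟨h1, h2⟩, h3⟩, h4⟩

/-- The vertices whose removal kills the color `k`. -/
def killers {m : ℕ} (f : Sym2 (Fin m) → ℕ) (k : ℕ) : Finset (Fin m) :=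
  Finset.univ.filter fun v => k ∉ colorsOn f (Finset.univ.erase v)

theorem mem_of_killers {m : ℕ} (f : Sym2 (Fin m) → ℕ) (e : Sym2 (Fin m)) (he : ¬ e.IsDiag)
    (v : Fin m) (hv : v ∈ killers f (f e)) : v ∈ e := by
  induction e using Sym2.ind with
  | _ a b =>
    simp only [killers, Finset.mem_filter, Finset.mem_univ, true_and, mem_colorsOn_iff] at hv
    by_contra h
    rw [Sym2.mem_iff, not_or] at h
    exact hv ⟨a, b, by simp [Ne.symm h.1], by simp [Ne.symm h.2], by simpa using he, rfl⟩

theorem killers_card_le {m : ℕ} (f : Sym2 (Fin m) → ℕ) (k : ℕ)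
    (hk : k ∈ colorsOn f Finset.univ) : (killers f k).card ≤ 2 := by
  obtain ⟨a, b, -, -, hab, rfl⟩ := (mem_colorsOn_iff _ _ _).1 hk
  refine le_trans (Finset.card_le_card (t := {a, b}) ?_) Finset.card_le_two
  intro v hv
  simpa using mem_of_killers f s(a, b) (by simpa using hab) v hv

theorem killers_card_le_one {m : ℕ} (f : Sym2 (Fin m) → ℕ) (e e' : Sym2 (Fin m))
    (he : ¬ e.IsDiag) (he' : ¬ e'.IsDiag) (hne : e ≠ e') (h : f e = f e') :
    (killers f (f e)).card ≤ 1 := by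
  rw [Finset.card_le_one]
  intro a ha b hb
  by_contra hab
  apply hne
  rw [(Sym2.mem_and_mem_iff hab).1 ⟨mem_of_killers f e he a ha, mem_of_killers f e he b hb⟩]
  rw [h] at ha hb
  rw [(Sym2.mem_and_mem_iff hab).1 ⟨mem_of_killers f e' he' a ha, mem_of_killers f e' he' b hb⟩]

theorem sum_killers {m : ℕ} (f : Sym2 (Fin m) → ℕ) :
    m * (colorsOn f Finset.univ).card =
      ∑ v, (colorsOn f (Finset.univ.erase v)).card
        + ∑ k ∈ colorsOn f Finset.univ, (killers f k).card := by
  have h1 : ∑ k ∈ colorsOn f Finset.univ, (killers f k).card =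
      ∑ v, ((colorsOn f Finset.univ).filter
        fun k => k ∉ colorsOn f (Finset.univ.erase v)).card := by
    simp only [killers, Finset.card_filter]
    exact Finset.sum_comm
  have h2 : ∀ v, (colorsOn f (Finset.univ.erase v)).card + ((colorsOn f Finset.univ).filter
        fun k => k ∉ colorsOn f (Finset.univ.erase v)).card = (colorsOn f Finset.univ).card := by
    intro v
    rw [← Finset.card_filter_add_card_filter_not (s := colorsOn f Finset.univ)
      (fun k => k ∈ colorsOn f (Finset.univ.erase v))]
    congr 2
    ext k
    simp only [Finset.mem_filter, iff_and_self, mem_colorsOn_iff]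
    rintro ⟨a, b, -, -, h, h'⟩
    exact ⟨a, b, by simp, by simp, h, h'⟩
  rw [h1, ← Finset.sum_add_distrib, Finset.sum_congr rfl (fun v _ => h2 v)]
  simp

/-- **Lemma.** Let `r ≥ 3` and let `M` be an edge-colored `K_{r+1}` with at least
`C(r,2) + 1` colors.  Then some `r`-clique `K ⊆ M` carries at least `C(r−1,2) + 2`
colors. -/
theorem many_colors_in_r_clique (r : ℕ) (hr : 3 ≤ r)
    (f : Sym2 (Fin (r + 1)) → ℕ)
    (hM : r * (r - 1) / 2 + 1 ≤ (colorsOn f Finset.univ).card) :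
    ∃ K : Finset (Fin (r + 1)), K.card = r ∧
      (r - 1) * (r - 2) / 2 + 2 ≤ (colorsOn f K).card := by
  by_contra hcon
  push Not at hcon
  have hv : ∀ v, (colorsOn f (Finset.univ.erase v)).card ≤ (r - 1) * (r - 2) / 2 + 1 := by
    intro v
    have := hcon (Finset.univ.erase v) (by simp)
    omega
  have hS := sum_killers f
  have hle : ∑ v, (colorsOn f (Finset.univ.erase v)).card
      ≤ (r + 1) * ((r - 1) * (r - 2) / 2 + 1) := by
    refine (Finset.sum_le_card_nsmul _ _ _ (fun v _ => hv v)).trans ?_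
    simp
  have hK : ∑ k ∈ colorsOn f Finset.univ, (killers f k).card
      ≤ (colorsOn f Finset.univ).card * 2 :=
    Finset.sum_le_card_nsmul _ _ _ (fun k hk => killers_card_le f k hk)
  obtain rfl | hr4 : r = 3 ∨ 4 ≤ r := by omega
  · norm_num at hM hle hS
    have hc : (colorsOn f Finset.univ).card = 4 := by omega
    have hlt : (colorsOn f Finset.univ).card <
        ((Finset.univ : Finset (Sym2 (Fin (3 + 1)))).filter fun e => ¬ e.IsDiag).card := by
      rw [hc]; decide
    obtain ⟨e, he, e', he', hne, h⟩ := Finset.exists_ne_map_eq_of_card_lt_of_maps_to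
      (f := f) hlt (by
        intro e he
        induction e using Sym2.ind with
        | _ a b =>
          rw [Finset.mem_coe, mem_colorsOn_iff]
          exact ⟨a, b, by simp, by simp, by simpa using he, rfl⟩)
    simp only [Finset.mem_filter, Finset.mem_univ, true_and] at he he'
    have h1 := killers_card_le_one f e e' he he' hne h
    have hmem : f e ∈ colorsOn f Finset.univ := by
      clear h1 h hne
      induction e using Sym2.ind with
      | _ a b =>
        rw [mem_colorsOn_iff]
        exact ⟨a, b, by simp, by simp, by simpa using he, rfl⟩
    have hlt2 : ∑ k ∈ colorsOn f Finset.univ, (killers f k).card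
        < ∑ k ∈ colorsOn f Finset.univ, 2 :=
      Finset.sum_lt_sum (fun k hk => killers_card_le f k hk) ⟨f e, hmem, by omega⟩
    simp only [Finset.sum_const, smul_eq_mul] at hlt2
    omega
  · obtain ⟨s, rfl⟩ : ∃ s, r = s + 2 := ⟨r - 2, by omega⟩
    have e1 : s + 2 - 1 = s + 1 := by omega
    have e2 : s + 2 - 2 = s := by omega
    rw [e1] at hM
    rw [e1, e2] at hle
    obtain ⟨A, hA⟩ : 2 ∣ (s + 1) * s := by
      rw [mul_comm]; exact (Nat.even_mul_succ_self s).two_dvd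
    have hB : (s + 2) * (s + 1) = 2 * (A + s + 1) := by linarith
    rw [hB, Nat.mul_div_cancel_left _ (by norm_num)] at hM
    rw [hA, Nat.mul_div_cancel_left _ (by norm_num)] at hle
    have hs : 2 ≤ s := by omega
    nlinarith [Nat.mul_le_mul_left (s + 1) hM]
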